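/- Under the stated setup, for every increasing set A ⊆ (K → Bool), every h ∈ ℝ, and every x ∈ K: ∫_{A^h} φ x dμ(φ) ≥ 0. Consequently ∫_{A^h} (Σ_{x∈K} κ x · φ x) dμ(φ) ≥ 0, so h ↦ μ(A^h) is non-increasing. (Positive correlation of increasing level-set events with the field, Remark 3.3(1).) -/

import Mathlib

open MeasureTheory Real

/-- The level-set event `A^h = {φ | (1{h ≤ φ x})_x ∈ A}`. -/
def levSet {K : Type} (A : Set (K → Bool)) (h : ℝ) : Set (K → ℝ) :=
  {φ | (fun x => decide (h ≤ φ x)) ∈ A}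

section LevelSetEvents

variable {K : Type}

theorem measurableSet_levSet [Finite K] (A : Set (K → Bool)) (h : ℝ) :
    MeasurableSet (levSet A h) := by
  have hm : Measurable fun (φ : K → ℝ) (x : K) => decide (h ≤ φ x) := by
    refine measurable_pi_lambda _ fun x => measurable_to_bool ?_
    have : (fun φ : K → ℝ => decide (h ≤ φ x)) ⁻¹' {true} = {φ | h ≤ φ x} := by
      ext φ
      simp
    rw [this]
    exact measurableSet_le measurable_const (measurable_pi_apply x)
  exact hm A.toFinite.measurableSet

theorem levSet_mono {A : Set (K → Bool)}
    (hA : ∀ ω ω' : K → Bool, ω ∈ A → (∀ y, ω y ≤ ω' y) → ω' ∈ A)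
    {h h' : ℝ} {φ ψ : K → ℝ} (hφ : φ ∈ levSet A h)
    (hle : ∀ x, h ≤ φ x → h' ≤ ψ x) : ψ ∈ levSet A h' := by
  refine hA _ _ hφ fun y => ?_
  rw [Bool.le_iff_imp]
  simpa using hle y

end LevelSetEvents

section Energy

variable {K : Type} [Fintype K]

/-- The operator `κ - Δ_c` of the network with conductances `c` and killing `κ`. -/
def killedLaplacian (c : K → K → ℝ) (κ : K → ℝ) : (K → ℝ) →ₗ[ℝ] (K → ℝ) where
  toFun v x := κ x * v x + ∑ y, c x y * (v x - v y)
  map_add' u v := by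
    ext x
    simp only [Pi.add_apply]
    rw [add_add_add_comm, ← Finset.sum_add_distrib, mul_add]
    congr 1
    exact Finset.sum_congr rfl fun y _ => by ring
  map_smul' r v := by
    ext x
    simp only [Pi.smul_apply, smul_eq_mul, RingHom.id_apply]
    rw [mul_add, Finset.mul_sum, mul_left_comm]
    congr 1
    exact Finset.sum_congr rfl fun y _ => by ring

theorem killedLaplacian_apply (c : K → K → ℝ) (κ v : K → ℝ) (x : K) :
    killedLaplacian c κ v x = κ x * v x + ∑ y, c x y * (v x - v y) := rfl

/-- The minimum principle. -/
theorem nonneg_of_killedLaplacian_nonneg {c : K → K → ℝ} (hpos : ∀ x y, 0 ≤ c x y)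
    {κ : K → ℝ} (hκ : ∀ x, 0 < κ x) {v : K → ℝ}
    (hv : ∀ x, 0 ≤ killedLaplacian c κ v x) (x : K) : 0 ≤ v x := by
  have : Nonempty K := ⟨x⟩
  obtain ⟨z, hz⟩ := Finite.exists_min v
  refine le_trans ?_ (hz x)
  have hs : ∑ y, c z y * (v z - v y) ≤ 0 :=
    Finset.sum_nonpos fun y _ => mul_nonpos_of_nonneg_of_nonpos (hpos z y) (by linarith [hz y])
  have h := hv z
  rw [killedLaplacian_apply] at h
  exact nonneg_of_mul_nonneg_right (by linarith) (hκ z)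

theorem killedLaplacian_surjective {c : K → K → ℝ} (hpos : ∀ x y, 0 ≤ c x y)
    {κ : K → ℝ} (hκ : ∀ x, 0 < κ x) : Function.Surjective (killedLaplacian c κ) := by
  rw [← LinearMap.injective_iff_surjective, injective_iff_map_eq_zero]
  intro v hv
  ext x
  refine le_antisymm ?_ (nonneg_of_killedLaplacian_nonneg hpos hκ (by simp [hv]) x)
  have := nonneg_of_killedLaplacian_nonneg hpos hκ (v := -v) (by simp [hv]) x
  simpa using this

theorem sum_sum_mul_sub_mul_sub {c : K → K → ℝ} (hsym : ∀ x y, c x y = c y x) (φ v : K → ℝ) :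
    ∑ x, ∑ y, c x y * ((φ y - φ x) * (v y - v x)) =
      2 * ∑ x, φ x * ∑ y, c x y * (v x - v y) := by
  have hswap : ∑ x, ∑ y, c x y * (φ y * (v y - v x)) =
      ∑ x, ∑ y, c x y * (φ x * (v x - v y)) := by
    rw [Finset.sum_comm]
    exact Finset.sum_congr rfl fun x _ => Finset.sum_congr rfl fun y _ => by rw [hsym]
  calc _ = ∑ x, ∑ y, c x y * (φ y * (v y - v x)) + ∑ x, ∑ y, c x y * (φ x * (v x - v y)) := by
        simp only [← Finset.sum_add_distrib]
        exact Finset.sum_congr rfl fun x _ => Finset.sum_congr rfl fun y _ => by ring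
    _ = _ := by
        rw [hswap, ← two_mul]
        congr 1
        refine Finset.sum_congr rfl fun x _ => ?_
        rw [Finset.mul_sum]
        exact Finset.sum_congr rfl fun y _ => by ring

theorem energy_add_smul {c : K → K → ℝ} (hsym : ∀ x y, c x y = c y x) {κ : K → ℝ}
    {E : (K → ℝ) → ℝ}
    (hE : ∀ φ : K → ℝ,
      E φ = (1 / 2) * ∑ x, ∑ y, c x y * (φ y - φ x) ^ 2 + ∑ x, κ x * (φ x) ^ 2)
    (φ v : K → ℝ) (t : ℝ) :
    E (φ + t • v) = E φ + 2 * t * ∑ x, φ x * killedLaplacian c κ v x + t ^ 2 * E v := by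
  have h1 : ∑ x, ∑ y, c x y * ((φ + t • v) y - (φ + t • v) x) ^ 2 =
      ∑ x, ∑ y, c x y * (φ y - φ x) ^ 2
        + 2 * t * ∑ x, ∑ y, c x y * ((φ y - φ x) * (v y - v x))
        + t ^ 2 * ∑ x, ∑ y, c x y * (v y - v x) ^ 2 := by
    simp only [Finset.mul_sum, ← Finset.sum_add_distrib, Pi.add_apply, Pi.smul_apply, smul_eq_mul]
    exact Finset.sum_congr rfl fun x _ => Finset.sum_congr rfl fun y _ => by ring
  have h2 : ∑ x, κ x * ((φ + t • v) x) ^ 2 =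
      ∑ x, κ x * (φ x) ^ 2 + 2 * t * ∑ x, φ x * (κ x * v x) + t ^ 2 * ∑ x, κ x * (v x) ^ 2 := by
    simp only [Finset.mul_sum, ← Finset.sum_add_distrib, Pi.add_apply, Pi.smul_apply, smul_eq_mul]
    exact Finset.sum_congr rfl fun x _ => by ring
  have h3 : ∑ x, φ x * killedLaplacian c κ v x =
      ∑ x, φ x * (κ x * v x) + ∑ x, φ x * ∑ y, c x y * (v x - v y) := by
    rw [← Finset.sum_add_distrib]
    exact Finset.sum_congr rfl fun x _ => by rw [killedLaplacian_apply, mul_add]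
  rw [hE, hE, hE, h1, h2, h3, sum_sum_mul_sub_mul_sub hsym]
  ring

theorem integrable_exp_neg_energy {c : K → K → ℝ} (hpos : ∀ x y, 0 ≤ c x y)
    {κ : K → ℝ} (hκ : ∀ x, 0 < κ x) {E : (K → ℝ) → ℝ} (hEc : Continuous E)
    (hE : ∀ φ : K → ℝ,
      E φ = (1 / 2) * ∑ x, ∑ y, c x y * (φ y - φ x) ^ 2 + ∑ x, κ x * (φ x) ^ 2) :
    Integrable fun φ : K → ℝ => Real.exp (-(E φ) / 2) := by
  have hprod : Integrable fun φ : K → ℝ => ∏ x, Real.exp (-(κ x / 2) * (φ x) ^ 2) :=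
    Integrable.fintype_prod fun x => integrable_exp_neg_mul_sq (half_pos (hκ x))
  refine hprod.mono' (by fun_prop) (ae_of_all _ fun φ => ?_)
  rw [Real.norm_eq_abs, abs_of_pos (Real.exp_pos _), ← Real.exp_sum, Real.exp_le_exp, hE]
  have h1 : 0 ≤ ∑ x, ∑ y, c x y * (φ y - φ x) ^ 2 :=
    Finset.sum_nonneg fun x _ => Finset.sum_nonneg fun y _ => mul_nonneg (hpos x y) (sq_nonneg _)
  have h2 : ∑ x, -(κ x / 2) * (φ x) ^ 2 = -(1 / 2) * ∑ x, κ x * (φ x) ^ 2 := by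
    rw [Finset.mul_sum]
    exact Finset.sum_congr rfl fun x _ => by ring
  linarith

/-- If `D` is stable under translation in direction `v`, then shifting a Gaussian weight along `v`
can only decrease its integral over `D`; to first order in the shift this gives the sign of the
integral over `D` of the derivative `ℓ` of the energy in direction `v`. -/
theorem setIntegral_mul_exp_nonneg {E ℓ : (K → ℝ) → ℝ} {v : K → ℝ} {C : ℝ}
    (hint : Integrable fun φ : K → ℝ => Real.exp (-(E φ) / 2))
    (hadd : ∀ (φ : K → ℝ) (t : ℝ), E (φ + t • v) = E φ + 2 * t * ℓ φ + t ^ 2 * C)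
    {D : Set (K → ℝ)} (hD : MeasurableSet D)
    (hDv : ∀ φ ∈ D, ∀ t : ℝ, 0 ≤ t → φ + t • v ∈ D) :
    0 ≤ ∫ φ in D, ℓ φ * Real.exp (-(E φ) / 2) := by
  by_cases hl : IntegrableOn (fun φ => ℓ φ * Real.exp (-(E φ) / 2)) D
  swap
  · rw [integral_undef hl]
  set g : (K → ℝ) → ℝ := fun φ => Real.exp (-(E φ) / 2) with hg
  have hshift : ∀ t : ℝ, 0 ≤ t → ∫ φ in D, g (φ + t • v) ≤ ∫ φ in D, g φ := by
    intro t ht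
    rw [← integral_indicator hD, ← integral_indicator hD,
      ← integral_add_right_eq_self (D.indicator g) (t • v)]
    refine integral_mono ((hint.comp_add_right (t • v)).indicator hD)
      ((hint.indicator hD).comp_add_right (t • v)) fun φ => ?_
    by_cases hφ : φ ∈ D
    · simp [hφ, hDv φ hφ t ht]
    · simp only [hφ, not_false_eq_true, Set.indicator_of_notMem]
      exact Set.indicator_nonneg (fun _ _ => (Real.exp_pos _).le) _
  set a := ∫ φ in D, ℓ φ * g φ
  set b := ∫ φ in D, g φ
  have hkey : ∀ t : ℝ, 0 < t → 0 ≤ a + t * (C * b / 2) := by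
    intro t ht
    have hsub : IntegrableOn (fun φ => g φ - t * (ℓ φ * g φ)) D :=
      hint.integrableOn.sub (hl.const_mul t)
    have hlower : ∫ φ in D, (g φ - t * (ℓ φ * g φ) - t ^ 2 * C / 2 * g φ) ≤
        ∫ φ in D, g (φ + t • v) := by
      refine integral_mono (hsub.sub (hint.integrableOn.const_mul _))
        (hint.comp_add_right (t • v)).integrableOn fun φ => ?_
      have hexp : g (φ + t • v) = g φ * Real.exp (-(t * ℓ φ) - t ^ 2 * C / 2) := by
        simp only [hg]
        rw [hadd, ← Real.exp_add]
        congr 1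
        ring
      have h1 := mul_le_mul_of_nonneg_left
        (Real.add_one_le_exp (-(t * ℓ φ) - t ^ 2 * C / 2)) (Real.exp_pos (-(E φ) / 2)).le
      simp only [hexp]
      simp only [hg]
      linarith
    rw [integral_sub hsub (hint.integrableOn.const_mul _),
      integral_sub hint.integrableOn (hl.const_mul t), integral_const_mul,
      integral_const_mul] at hlower
    have h2 := hlower.trans (hshift t ht.le)
    refine nonneg_of_mul_nonneg_right (a := t) ?_ ht
    simp only [a, b]
    linarith
  have hlim : Filter.Tendsto (fun t : ℝ => a + t * (C * b / 2)) (nhdsWithin 0 (Set.Ioi 0))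
      (nhds a) := by
    have : Continuous fun t : ℝ => a + t * (C * b / 2) := by fun_prop
    simpa using (this.tendsto 0).mono_left nhdsWithin_le_nhds
  exact ge_of_tendsto hlim (eventually_mem_nhdsWithin.mono fun t ht => hkey t ht)

end Energy

/-- **Positive correlation of increasing level-set events with the field**
(Remark 3.3(1)): for every increasing `A`, level `h`, and site `x`,
`∫_{A^h} φ x dμ ≥ 0`; consequently `∫_{A^h} Σ_x κ x · φ x dμ ≥ 0`, and
`h ↦ μ(A^h)` is non-increasing. -/
theorem increasing_events_positively_correlated
    (K : Type) [Fintype K] [Nonempty K]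
    (c : K → K → ℝ) (hsym : ∀ x y, c x y = c y x) (hpos : ∀ x y, 0 ≤ c x y)
    (κ : K → ℝ) (hκ : ∀ x, 0 < κ x)
    (E : (K → ℝ) → ℝ)
    (hE : ∀ φ : K → ℝ,
      E φ = (1 / 2) * ∑ x, ∑ y, c x y * (φ y - φ x) ^ 2 + ∑ x, κ x * (φ x) ^ 2)
    (Z : ℝ) (hZ : Z = ∫ φ : K → ℝ, Real.exp (-(E φ) / 2))
    (μ : Measure (K → ℝ))
    (hμ : μ = volume.withDensity fun φ => ENNReal.ofReal (Real.exp (-(E φ) / 2) / Z))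
    (A : Set (K → Bool))
    (hA : ∀ ω ω' : K → Bool, ω ∈ A → (∀ y, ω y ≤ ω' y) → ω' ∈ A) :
    (∀ (h : ℝ) (x : K), 0 ≤ ∫ φ in levSet A h, φ x ∂μ) ∧
    (∀ h : ℝ, 0 ≤ ∫ φ in levSet A h, (∑ x, κ x * φ x) ∂μ) ∧
    Antitone (fun h : ℝ => μ (levSet A h)) := by
  have hEc : Continuous E := by
    rw [funext hE]
    fun_prop
  have hint := integrable_exp_neg_energy hpos hκ hEc hE
  have hZ0 : 0 ≤ Z := hZ ▸ integral_nonneg fun φ => (Real.exp_pos _).le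
  have key : ∀ (h : ℝ) (v : K → ℝ), (∀ x, 0 ≤ v x) →
      0 ≤ ∫ φ in levSet A h, (∑ x, φ x * killedLaplacian c κ v x) ∂μ := by
    intro h v hv
    have hD := measurableSet_levSet A h
    have h0 := setIntegral_mul_exp_nonneg hint (fun φ t => energy_add_smul hsym hE φ v t) hD
      fun φ hφ t ht => levSet_mono hA hφ fun x hx => by
        have := mul_nonneg ht (hv x)
        simp only [Pi.add_apply, Pi.smul_apply, smul_eq_mul]
        linarith
    have hm : Measurable fun φ : K → ℝ => ENNReal.ofReal (Real.exp (-(E φ) / 2) / Z) := by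
      have := hEc.measurable
      fun_prop
    rw [hμ, setIntegral_withDensity_eq_setIntegral_toReal_smul hm
      (ae_of_all _ fun _ => ENNReal.ofReal_lt_top) _ hD]
    have heq : ∀ φ : K → ℝ, (ENNReal.ofReal (Real.exp (-(E φ) / 2) / Z)).toReal •
        (∑ x, φ x * killedLaplacian c κ v x) =
        Z⁻¹ * ((∑ x, φ x * killedLaplacian c κ v x) * Real.exp (-(E φ) / 2)) := by
      intro φ
      rw [ENNReal.toReal_ofReal (by positivity), smul_eq_mul]
      ring
    simp only [heq, integral_const_mul]
    exact mul_nonneg (inv_nonneg.mpr hZ0) h0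
  refine ⟨fun h x => ?_, fun h => ?_, fun h h' hh => ?_⟩
  · classical
    obtain ⟨v, hv⟩ := killedLaplacian_surjective hpos hκ (Pi.single x 1)
    have hv0 := nonneg_of_killedLaplacian_nonneg hpos hκ (v := v) fun y => by
      rw [hv]
      exact (Pi.single_nonneg.mpr zero_le_one : (0 : K → ℝ) ≤ Pi.single x 1) y
    simpa [hv, Pi.single_apply] using key h v hv0
  · simpa [killedLaplacian_apply, mul_comm] using key h 1 fun _ => zero_le_one
  · exact measure_mono fun φ hφ => levSet_mono hA hφ fun x hx => hh.trans hx
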